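/- Characterization of stationary points: let F(λ) = ( −ln( ∑_h π(h)e^{−nλ L̂(h)} ) + ln(2√n/δ) )/( nλ(1−λ/2) ) on (0,2). Then F is differentiable, and F'(λ) = 0 if and only if 2(1−λ)( KL(ρ_λ‖π) + ln(2√n/δ) ) = λ²n·E_{ρ_λ}[L̂]. -/

import Mathlib

open Finset

/-- Gibbs posterior `ρ_λ(h) = π(h)·e^{−λn L̂(h)} / ∑_{h'} π(h')·e^{−λn L̂(h')}`. -/
noncomputable def gibbs {H : Type*} [Fintype H] (π Lhat : H → ℝ) (n : ℕ) (lam : ℝ)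
    (h : H) : ℝ :=
  π h * Real.exp (-lam * n * Lhat h) / ∑ h', π h' * Real.exp (-lam * n * Lhat h')

/-- KL divergence between distributions on a finite set. -/
noncomputable def KLf {H : Type*} [Fintype H] (ρ π : H → ℝ) : ℝ :=
  ∑ h, ρ h * Real.log (ρ h / π h)

/-- The bound along the Gibbs path:
`F(λ) = (−ln(∑_h π(h)e^{−nλL̂(h)}) + ln(2√n/δ))/(nλ(1−λ/2))`. -/
noncomputable def Fbound {H : Type*} [Fintype H] (π Lhat : H → ℝ) (n : ℕ) (δ : ℝ)
    (lam : ℝ) : ℝ :=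
  (-Real.log (∑ h, π h * Real.exp (-(n : ℝ) * lam * Lhat h)) +
      Real.log (2 * Real.sqrt n / δ)) / ((n : ℝ) * lam * (1 - lam / 2))

/-- Characterization of stationary points: `F` is differentiable on `(0,2)` and
`F'(λ) = 0` iff `2(1−λ)(KL(ρ_λ‖π) + ln(2√n/δ)) = λ²n·E_{ρ_λ}[L̂]`. -/
theorem stationary_points_characterization
    {H : Type*} [Fintype H] [Nonempty H]
    (π : H → ℝ) (hπpos : ∀ h, 0 < π h) (hπsum : ∑ h, π h = 1)
    (Lhat : H → ℝ) (hL : ∀ h, Lhat h ∈ Set.Icc (0 : ℝ) 1)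
    (n : ℕ) (hn : 0 < n) (δ : ℝ) (hδ : δ ∈ Set.Ioo (0 : ℝ) 1)
    (lam : ℝ) (hlam : lam ∈ Set.Ioo (0 : ℝ) 2) :
    DifferentiableAt ℝ (Fbound π Lhat n δ) lam ∧
      (deriv (Fbound π Lhat n δ) lam = 0 ↔
        2 * (1 - lam) * (KLf (gibbs π Lhat n lam) π + Real.log (2 * Real.sqrt n / δ)) =
          lam ^ 2 * (n : ℝ) * ∑ h, gibbs π Lhat n lam h * Lhat h) := by
  obtain ⟨h0, h2⟩ := hlam
  have hnR : (0 : ℝ) < n := by exact_mod_cast hn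
  set C := Real.log (2 * Real.sqrt n / δ) with hC
  set Z := ∑ h, π h * Real.exp (-(n : ℝ) * lam * Lhat h) with hZ
  have hZpos : 0 < Z :=
    Finset.sum_pos (fun h _ => mul_pos (hπpos h) (Real.exp_pos _)) Finset.univ_nonempty
  have hg : ∀ h, gibbs π Lhat n lam h = π h * Real.exp (-(n : ℝ) * lam * Lhat h) / Z := by
    intro h
    have e : ∀ h, -lam * (n : ℝ) * Lhat h = -(n : ℝ) * lam * Lhat h := fun h => by ring
    simp only [gibbs, e, hZ]
  have hgsum : ∑ h, gibbs π Lhat n lam h = 1 := by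
    simp only [hg]
    rw [← Finset.sum_div, ← hZ, div_self hZpos.ne']
  set E := ∑ h, gibbs π Lhat n lam h * Lhat h with hE
  have hKL : KLf (gibbs π Lhat n lam) π = -(n : ℝ) * lam * E - Real.log Z := by
    have key : ∀ h, gibbs π Lhat n lam h * Real.log (gibbs π Lhat n lam h / π h)
        = -(n : ℝ) * lam * (gibbs π Lhat n lam h * Lhat h)
          - gibbs π Lhat n lam h * Real.log Z := by
      intro h
      have e : gibbs π Lhat n lam h / π h = Real.exp (-(n : ℝ) * lam * Lhat h) / Z := by
        rw [hg]
        have := (hπpos h).ne'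
        field_simp
      rw [e, Real.log_div (Real.exp_pos _).ne' hZpos.ne', Real.log_exp]
      ring
    unfold KLf
    simp only [key]
    rw [Finset.sum_sub_distrib, ← Finset.mul_sum, ← Finset.sum_mul, hgsum, one_mul]
  have hZd : HasDerivAt (fun l : ℝ => ∑ h, π h * Real.exp (-(n : ℝ) * l * Lhat h))
      (∑ h, π h * (Real.exp (-(n : ℝ) * lam * Lhat h) * (-(n : ℝ) * 1 * Lhat h))) lam := by
    apply HasDerivAt.fun_sum
    intro h _
    exact ((((hasDerivAt_id lam).const_mul (-(n : ℝ))).mul_const (Lhat h)).exp).const_mul (π h)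
  have hZ' : ∑ h, π h * (Real.exp (-(n : ℝ) * lam * Lhat h) * (-(n : ℝ) * 1 * Lhat h))
      = -(n : ℝ) * E * Z := by
    rw [show -(n : ℝ) * E * Z = (-(n : ℝ) * Z) * E by ring, hE,
      Finset.mul_sum Finset.univ (fun h => gibbs π Lhat n lam h * Lhat h)]
    refine Finset.sum_congr rfl fun h _ => ?_
    rw [hg]
    have := hZpos.ne'
    field_simp
  rw [hZ'] at hZd
  have hnum : HasDerivAt (fun l : ℝ =>
      -Real.log (∑ h, π h * Real.exp (-(n : ℝ) * l * Lhat h)) + C) ((n : ℝ) * E) lam := by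
    have := ((hZd.log hZpos.ne').neg).add_const C
    refine this.congr_deriv ?_
    rw [← hZ]
    have := hZpos.ne'
    field_simp
  have hden : HasDerivAt (fun l : ℝ => (n : ℝ) * l * (1 - l / 2)) ((n : ℝ) * (1 - lam)) lam := by
    have := ((hasDerivAt_id lam).const_mul (n : ℝ)).mul
      (((hasDerivAt_id lam).div_const 2).const_sub 1)
    refine this.congr_deriv ?_
    simp only [id]
    ring
  have hdpos : 0 < (n : ℝ) * lam * (1 - lam / 2) :=
    mul_pos (mul_pos hnR h0) (by linarith)
  have hF : HasDerivAt (Fbound π Lhat n δ) _ lam := hnum.div hden hdpos.ne'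
  refine ⟨hF.differentiableAt, ?_⟩
  rw [hF.deriv, ← hZ, hKL, div_eq_zero_iff]
  have hsq : ((n : ℝ) * lam * (1 - lam / 2)) ^ 2 ≠ 0 := (pow_pos hdpos 2).ne'
  constructor
  · rintro (h | h)
    · have h' : (n : ℝ) * (n * E * (lam * (1 - lam / 2)) - (-Real.log Z + C) * (1 - lam)) = 0 := by
        linear_combination h
      rcases mul_eq_zero.mp h' with h' | h'
      · exact absurd h' hnR.ne'
      · linear_combination -2 * h'
    · exact absurd h hsq
  · intro h
    left
    linear_combination -(n : ℝ) / 2 * h
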